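/- Let A be a real m×n semi-monotone matrix (A† ≥ 0) with A ≥ 0 entrywise, and let A = M − N = U − V be two proper regular splittings of A such that the range of M + U − A equals the range of A and the null space of M + U − A equals the null space of A. Then ρ(U†V M†N) ≤ min{ρ(U†V), ρ(M†N)} < 1. -/

import Mathlib

open Matrix

/-- `G` is the Moore-Penrose inverse of `A` (the four Penrose equations). -/
def IsMoorePenrose {m n : ℕ} (A : Matrix (Fin m) (Fin n) ℝ)
    (G : Matrix (Fin n) (Fin m) ℝ) : Prop :=
  A * G * A = A ∧ G * A * G = G ∧ (A * G)ᵀ = A * G ∧ (G * A)ᵀ = G * A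

/-- `A = U - V` is a proper splitting: `range U = range A` and `null U = null A`. -/
def IsProperSplitting {m n : ℕ} (A U V : Matrix (Fin m) (Fin n) ℝ) : Prop :=
  A = U - V ∧
    LinearMap.range U.mulVecLin = LinearMap.range A.mulVecLin ∧
    LinearMap.ker U.mulVecLin = LinearMap.ker A.mulVecLin

/-- The spectral radius of a real square matrix: the maximum modulus of its
complex eigenvalues. -/
noncomputable def specRad {k : ℕ} (X : Matrix (Fin k) (Fin k) ℝ) : ℝ :=
  (spectralRadius ℂ (X.map Complex.ofReal)).toReal

/-- Right multiplication by `M† M` fixes every matrix vanishing on the kernel of `M`. -/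
lemma IsMoorePenrose.mul_mul_of_ker_le {m n p : ℕ} {M : Matrix (Fin m) (Fin n) ℝ}
    {Md : Matrix (Fin n) (Fin m) ℝ} (hM : IsMoorePenrose M Md) {B : Matrix (Fin p) (Fin n) ℝ}
    (h : LinearMap.ker M.mulVecLin ≤ LinearMap.ker B.mulVecLin) : B * (Md * M) = B := by
  apply Matrix.mulVec_injective
  funext x
  have hx : (Md * M) *ᵥ x - x ∈ LinearMap.ker M.mulVecLin := by
    rw [LinearMap.mem_ker, mulVecLin_apply, mulVec_sub, mulVec_mulVec, ← Matrix.mul_assoc, hM.1,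
      sub_self]
  have h' := h hx
  rw [LinearMap.mem_ker, mulVecLin_apply, mulVec_sub, mulVec_mulVec] at h'
  exact sub_eq_zero.mp h'

/-- Left multiplication by `A A†` fixes every matrix whose range lies in that of `A`. -/
lemma IsMoorePenrose.mul_mul_of_range_le {m n p : ℕ} {A : Matrix (Fin m) (Fin n) ℝ}
    {Ad : Matrix (Fin n) (Fin m) ℝ} (hA : IsMoorePenrose A Ad) {B : Matrix (Fin m) (Fin p) ℝ}
    (h : LinearMap.range B.mulVecLin ≤ LinearMap.range A.mulVecLin) : A * Ad * B = B := by
  apply Matrix.mulVec_injective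
  funext x
  obtain ⟨y, hy⟩ := h (LinearMap.mem_range_self B.mulVecLin x)
  simp only [mulVecLin_apply] at hy
  rw [← mulVec_mulVec, ← hy, mulVec_mulVec, hA.1]

/-- If `ker U ≤ ker M` then `U† U` fixes `M†` from the left. -/
lemma IsMoorePenrose.proj_mul_of_ker_le {m n : ℕ} {M U : Matrix (Fin m) (Fin n) ℝ}
    {Md Ud : Matrix (Fin n) (Fin m) ℝ} (hM : IsMoorePenrose M Md) (hU : IsMoorePenrose U Ud)
    (h : LinearMap.ker U.mulVecLin ≤ LinearMap.ker M.mulVecLin) : Ud * U * Md = Md := by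
  have hproj : Ud * U * (Md * M) = Md * M := by
    rw [← hU.2.2.2, ← hM.2.2.2, ← transpose_mul, Matrix.mul_assoc, hU.mul_mul_of_ker_le h]
  calc Ud * U * Md = Ud * U * (Md * M) * Md := by
        rw [Matrix.mul_assoc (Ud * U), hM.2.1]
    _ = Md := by rw [hproj, hM.2.1]

/-- If `range U ≤ range A` then `A A†` fixes `U†` from the right. -/
lemma IsMoorePenrose.mul_proj_of_range_le {m n : ℕ} {A U : Matrix (Fin m) (Fin n) ℝ}
    {Ad Ud : Matrix (Fin n) (Fin m) ℝ} (hA : IsMoorePenrose A Ad) (hU : IsMoorePenrose U Ud)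
    (h : LinearMap.range U.mulVecLin ≤ LinearMap.range A.mulVecLin) : Ud * (A * Ad) = Ud := by
  have hproj : U * Ud * (A * Ad) = U * Ud := by
    rw [← hU.2.2.1, ← hA.2.2.1, ← transpose_mul, ← Matrix.mul_assoc, hA.mul_mul_of_range_le h]
  calc Ud * (A * Ad) = Ud * (U * Ud * (A * Ad)) := by
        rw [← Matrix.mul_assoc Ud (U * Ud), ← Matrix.mul_assoc Ud U, hU.2.1]
    _ = Ud := by rw [hproj, ← Matrix.mul_assoc, hU.2.1]

lemma Matrix.mul_entry_nonneg {m n p : ℕ} {A : Matrix (Fin m) (Fin n) ℝ}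
    {B : Matrix (Fin n) (Fin p) ℝ} (hA : ∀ i j, 0 ≤ A i j) (hB : ∀ i j, 0 ≤ B i j) (i j) :
    0 ≤ (A * B) i j := by
  rw [mul_apply]
  exact Finset.sum_nonneg fun k _ => mul_nonneg (hA i k) (hB k j)

lemma Matrix.pow_entry_nonneg {k : ℕ} {X : Matrix (Fin k) (Fin k) ℝ} (hX : ∀ i j, 0 ≤ X i j)
    (t : ℕ) : ∀ i j, 0 ≤ (X ^ t) i j := by
  induction t with
  | zero => intro i j; rw [pow_zero, one_apply]; split_ifs <;> norm_num
  | succ t ih => rw [pow_succ]; exact mul_entry_nonneg ih hX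

lemma Matrix.pow_entry_le_pow_entry {k : ℕ} {X Y : Matrix (Fin k) (Fin k) ℝ}
    (hX : ∀ i j, 0 ≤ X i j) (hXY : ∀ i j, X i j ≤ Y i j) (t : ℕ) :
    ∀ i j, (X ^ t) i j ≤ (Y ^ t) i j := by
  induction t with
  | zero => simp
  | succ t ih =>
    intro i j
    rw [pow_succ, pow_succ, mul_apply, mul_apply]
    exact Finset.sum_le_sum fun l _ => mul_le_mul (ih i l) (hXY l j) (hX l j)
      ((pow_entry_nonneg hX t i l).trans (ih i l))

lemma Matrix.map_ofReal_pow {k : ℕ} (X : Matrix (Fin k) (Fin k) ℝ) (t : ℕ) :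
    (X.map Complex.ofReal) ^ t = (X ^ t).map Complex.ofReal :=
  (map_pow (Complex.ofRealHom.mapMatrix : Matrix (Fin k) (Fin k) ℝ →+* _) X t).symm

section SpectralRadius

attribute [local instance] Matrix.linftyOpNormedRing Matrix.linftyOpNormedAlgebra

lemma spectralRadius_matrix_ne_top {k : ℕ} (X : Matrix (Fin k) (Fin k) ℂ) :
    spectralRadius ℂ X ≠ ⊤ := by
  rcases isEmpty_or_nonempty (Fin k) with h | h
  · rw [spectrum.SpectralRadius.of_subsingleton]
    exact ENNReal.zero_ne_top
  · exact ((spectrum.spectralRadius_le_nnnorm X).trans_lt ENNReal.coe_lt_top).ne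

/-- The spectral radius is monotone on entrywise nonnegative matrices. -/
lemma specRad_mono {k : ℕ} {X Y : Matrix (Fin k) (Fin k) ℝ}
    (hX : ∀ i j, 0 ≤ X i j) (hXY : ∀ i j, X i j ≤ Y i j) : specRad X ≤ specRad Y := by
  apply ENNReal.toReal_mono (spectralRadius_matrix_ne_top _)
  refine le_of_tendsto_of_tendsto'
    (spectrum.pow_nnnorm_pow_one_div_tendsto_nhds_spectralRadius _)
    (spectrum.pow_nnnorm_pow_one_div_tendsto_nhds_spectralRadius _) fun t => ?_
  refine ENNReal.rpow_le_rpow ?_ (by positivity)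
  rw [ENNReal.coe_le_coe, Matrix.map_ofReal_pow, Matrix.map_ofReal_pow,
    Matrix.linfty_opNNNorm_def, Matrix.linfty_opNNNorm_def]
  refine Finset.sup_mono_fun fun i _ => Finset.sum_le_sum fun j _ => ?_
  rw [← NNReal.coe_le_coe, coe_nnnorm, coe_nnnorm, map_apply, map_apply,
    Complex.norm_real, Complex.norm_real, Real.norm_eq_abs, Real.norm_eq_abs]
  exact abs_le_abs_of_nonneg (Matrix.pow_entry_nonneg hX t i j)
    (Matrix.pow_entry_le_pow_entry hX hXY t i j)

/-- A matrix whose powers tend to zero entrywise has spectral radius below one. -/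
lemma specRad_lt_one_of_tendsto_pow {k : ℕ} {X : Matrix (Fin k) (Fin k) ℝ}
    (h : ∀ i j, Filter.Tendsto (fun t : ℕ => (X ^ t) i j) Filter.atTop (nhds 0)) :
    specRad X < 1 := by
  rcases isEmpty_or_nonempty (Fin k) with hk | hk
  · rw [specRad, spectrum.SpectralRadius.of_subsingleton]
    norm_num
  have hlim : Filter.Tendsto (fun t : ℕ => (X.map Complex.ofReal) ^ t) Filter.atTop (nhds 0) := by
    refine tendsto_pi_nhds.2 fun i => tendsto_pi_nhds.2 fun j => ?_
    simp only [Matrix.map_ofReal_pow, map_apply]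
    exact (Complex.continuous_ofReal.tendsto' 0 0 Complex.ofReal_zero).comp (h i j)
  have hnorm : Filter.Tendsto (fun t : ℕ => ‖(X.map Complex.ofReal) ^ t‖₊) Filter.atTop
      (nhds 0) := by
    simpa using hlim.nnnorm
  obtain ⟨t, hlt, ht⟩ := ((hnorm.eventually_lt_const zero_lt_one).and
    (Filter.eventually_ne_atTop 0)).exists
  have hpow : spectralRadius ℂ (X.map Complex.ofReal) ^ t < 1 :=
    ((spectrum.spectralRadius_pow_le _ t ht).trans (spectrum.spectralRadius_le_nnnorm _)).trans_lt
      (ENNReal.coe_lt_one_iff.2 hlt)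
  have hone : spectralRadius ℂ (X.map Complex.ofReal) < 1 := by
    contrapose! hpow
    exact one_le_pow₀ hpow
  exact ENNReal.toReal_lt_of_lt_ofReal (by rwa [ENNReal.ofReal_one])

end SpectralRadius

/-- A proper regular splitting of a semi-monotone matrix is convergent. -/
lemma specRad_lt_one_of_properRegularSplitting {m n : ℕ} {A U V : Matrix (Fin m) (Fin n) ℝ}
    {Ad Ud : Matrix (Fin n) (Fin m) ℝ} (hA : IsMoorePenrose A Ad) (hU : IsMoorePenrose U Ud)
    (hsemi : ∀ i j, 0 ≤ Ad i j) (hPS : IsProperSplitting A U V)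
    (hUd : ∀ i j, 0 ≤ Ud i j) (hV : ∀ i j, 0 ≤ V i j) : specRad (Ud * V) < 1 := by
  obtain ⟨hAUV, hrange, hker⟩ := hPS
  have hT := mul_entry_nonneg hUd hV
  have hV_eq : V = U - A := by rw [hAUV, sub_sub_cancel]
  have hstep : Ud * V * Ad = Ad - Ud := by
    rw [hV_eq, Matrix.mul_sub, Matrix.sub_mul, hA.proj_mul_of_ker_le hU hker.le,
      Matrix.mul_assoc Ud A, hA.mul_proj_of_range_le hU hrange.le]
  have hsum (N : ℕ) :
      ∑ t ∈ Finset.range N, (Ud * V) ^ t * Ud = Ad - (Ud * V) ^ N * Ad := by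
    induction N with
    | zero => simp
    | succ N ih =>
      rw [Finset.sum_range_succ, ih, pow_succ, Matrix.mul_assoc _ (Ud * V) Ad, hstep,
        Matrix.mul_sub]
      abel
  refine specRad_lt_one_of_tendsto_pow fun i j => ?_
  refine (Filter.tendsto_add_atTop_iff_nat 1).1 (Summable.tendsto_atTop_zero ?_)
  refine summable_of_sum_range_le (c := (Ad * V) i j)
    (fun t => pow_entry_nonneg hT (t + 1) i j) fun N => ?_
  have hpow : ∑ t ∈ Finset.range N, (Ud * V) ^ (t + 1) = Ad * V - (Ud * V) ^ N * (Ad * V) := by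
    rw [← Matrix.mul_assoc _ Ad V, ← Matrix.sub_mul, ← hsum, Matrix.sum_mul]
    exact Finset.sum_congr rfl fun t _ => by rw [pow_succ, Matrix.mul_assoc _ Ud V]
  rw [← Matrix.sum_apply, hpow, Matrix.sub_apply]
  exact sub_le_self _
    (mul_entry_nonneg (pow_entry_nonneg hT N) (mul_entry_nonneg hsemi hV) i j)

theorem stmt17 {m n : ℕ} (A M N U V : Matrix (Fin m) (Fin n) ℝ)
    (Ad Md Ud : Matrix (Fin n) (Fin m) ℝ)
    (hA : IsMoorePenrose A Ad) (hM : IsMoorePenrose M Md) (hU : IsMoorePenrose U Ud)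
    (hsemi : ∀ i j, 0 ≤ Ad i j) (hApos : ∀ i j, 0 ≤ A i j)
    -- A = M - N is a proper regular splitting
    (hPSM : IsProperSplitting A M N)
    (hMd : ∀ i j, 0 ≤ Md i j) (hN : ∀ i j, 0 ≤ N i j)
    -- A = U - V is a proper regular splitting
    (hPSU : IsProperSplitting A U V)
    (hUd : ∀ i j, 0 ≤ Ud i j) (hV : ∀ i j, 0 ≤ V i j)
    (hrange : LinearMap.range (M + U - A).mulVecLin = LinearMap.range A.mulVecLin)
    (hker : LinearMap.ker (M + U - A).mulVecLin = LinearMap.ker A.mulVecLin) :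
    specRad (Ud * V * (Md * N)) ≤ min (specRad (Ud * V)) (specRad (Md * N)) ∧
      min (specRad (Ud * V)) (specRad (Md * N)) < 1 := by
  have hT := mul_entry_nonneg hUd hV
  have hS := mul_entry_nonneg hMd hN
  have hH := mul_entry_nonneg hT hS
  have hlt := specRad_lt_one_of_properRegularSplitting hA hU hsemi hPSU hUd hV
  obtain ⟨hAMN, -, hkerM⟩ := hPSM
  obtain ⟨hAUV, -, hkerU⟩ := hPSU
  have hN_eq : N = M - A := by rw [hAMN, sub_sub_cancel]
  have hV_eq : V = U - A := by rw [hAUV, sub_sub_cancel]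
  have hleft : Ud * V * (Md * N) = Ud * V - Ud * V * (Md * A) := by
    have hfix : V * (Md * M) = V := by
      rw [hV_eq, Matrix.sub_mul, hM.mul_mul_of_ker_le (hkerM.trans hkerU.symm).le,
        hM.mul_mul_of_ker_le hkerM.le]
    rw [hN_eq, Matrix.mul_sub, Matrix.mul_sub, Matrix.mul_assoc Ud V (Md * M), hfix]
  have hright : Ud * V * (Md * N) = Md * N - Ud * A * (Md * N) := by
    rw [hV_eq, Matrix.mul_sub, Matrix.sub_mul, ← Matrix.mul_assoc (Ud * U),
      hM.proj_mul_of_ker_le hU (hkerU.trans hkerM.symm).le]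
  refine ⟨le_min (specRad_mono hH fun i j => ?_) (specRad_mono hH fun i j => ?_),
    min_lt_of_left_lt hlt⟩
  · rw [hleft, Matrix.sub_apply]
    exact sub_le_self _ (mul_entry_nonneg hT (mul_entry_nonneg hMd hApos) i j)
  · rw [hright, Matrix.sub_apply]
    exact sub_le_self _ (mul_entry_nonneg (mul_entry_nonneg hUd hApos) hS i j)
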